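/- For the additive two-way wiretap channel, I(Y_1 ; Z | X_1) = log q − H(N_1 − b_1·b_3^{−1}·N_3). -/

import Mathlib

open Finset

noncomputable section

/-- Distribution (PMF) of a random variable `X` on a finite probability space `(Ω, μ)`. -/
def dist' {Ω A : Type*} [Fintype Ω] [DecidableEq A] (μ : Ω → ℝ) (X : Ω → A) (a : A) : ℝ :=
  ∑ ω, if X ω = a then μ ω else 0

/-- Shannon entropy (natural logarithm) of a random variable `X` on `(Ω, μ)`. -/
def entropy' {Ω A : Type*} [Fintype Ω] [Fintype A] [DecidableEq A]
    (μ : Ω → ℝ) (X : Ω → A) : ℝ :=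
  -∑ a, dist' μ X a * Real.log (dist' μ X a)

/-- Shannon mutual information `I(X;Y)` (natural logarithm). -/
def mi {Ω A B : Type*} [Fintype Ω] [Fintype A] [Fintype B] [DecidableEq A] [DecidableEq B]
    (μ : Ω → ℝ) (X : Ω → A) (Y : Ω → B) : ℝ :=
  entropy' μ X + entropy' μ Y - entropy' μ (fun ω => (X ω, Y ω))

/-- Shannon conditional mutual information `I(X;Y|C)` (natural logarithm),
via `I(X;Y|C) = H(X,C) + H(Y,C) − H(X,Y,C) − H(C)`. -/
def cmi {Ω A B C : Type*} [Fintype Ω] [Fintype A] [Fintype B] [Fintype C]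
    [DecidableEq A] [DecidableEq B] [DecidableEq C]
    (μ : Ω → ℝ) (X : Ω → A) (Y : Ω → B) (C' : Ω → C) : ℝ :=
  entropy' μ (fun ω => (X ω, C' ω)) + entropy' μ (fun ω => (Y ω, C' ω)) -
    entropy' μ (fun ω => (X ω, Y ω, C' ω)) - entropy' μ C'

section

variable {Ω A B G : Type*} [Fintype Ω] [DecidableEq A] [DecidableEq B] [DecidableEq G]

theorem dist'_comp_eq_sum [Fintype A] (μ : Ω → ℝ) (X : Ω → A) (f : A → B) (b : B) :
    dist' μ (fun ω => f (X ω)) b = ∑ a, if f a = b then dist' μ X a else 0 := by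
  simp only [dist', ← Finset.sum_filter]
  rw [Finset.sum_comm' (t' := univ.filter fun ω => f (X ω) = b) (s' := fun ω => {X ω})]
  · simp
  · grind

theorem dist'_comp_injective (μ : Ω → ℝ) (X : Ω → A) {f : A → B} (hf : Function.Injective f)
    (a : A) : dist' μ (fun ω => f (X ω)) (f a) = dist' μ X a := by
  simp [dist', hf.eq_iff]

theorem sum_dist' [Fintype A] (μ : Ω → ℝ) (X : Ω → A) : ∑ a, dist' μ X a = ∑ ω, μ ω := by
  simp only [dist']
  rw [Finset.sum_comm]
  simp

theorem sum_dist'_prod_right [Fintype B] (μ : Ω → ℝ) (X : Ω → A) (Y : Ω → B) (a : A) :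
    ∑ b, dist' μ (fun ω => (X ω, Y ω)) (a, b) = dist' μ X a := by
  simp only [dist', Prod.mk.injEq]
  rw [Finset.sum_comm]
  simp [ite_and]

theorem entropy'_comp_bijective [Fintype A] [Fintype B] (μ : Ω → ℝ) (X : Ω → A) {f : A → B}
    (hf : Function.Bijective f) : entropy' μ (fun ω => f (X ω)) = entropy' μ X := by
  rw [entropy', entropy', ← hf.sum_comp]
  simp only [dist'_comp_injective μ X hf.injective]

theorem entropy'_const [Fintype A] (μ : Ω → ℝ) (hμ : ∑ ω, μ ω = 1) (a : A) :
    entropy' μ (fun _ : Ω => a) = 0 := by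
  have h (b : A) : dist' μ (fun _ : Ω => a) b = if a = b then 1 else 0 := by
    by_cases hab : a = b <;> simp [dist', hab, hμ]
  simp [entropy', h]

theorem entropy'_uniform [Fintype A] [Nonempty A] (μ : Ω → ℝ) (X : Ω → A)
    (hX : ∀ a, dist' μ X a = 1 / (Fintype.card A : ℝ)) :
    entropy' μ X = Real.log (Fintype.card A) := by
  simp [entropy', hX]

/-- Adjoining an independent uniform variable increases the entropy by the logarithm of the
size of its range. -/
theorem entropy'_prod_uniform [Fintype A] [Fintype B] [Nonempty B] (μ : Ω → ℝ)
    (hμ : ∑ ω, μ ω = 1) (X : Ω → A) (T : Ω → B)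
    (h : ∀ a b, dist' μ (fun ω => (X ω, T ω)) (a, b) = dist' μ X a / Fintype.card B) :
    entropy' μ (fun ω => (X ω, T ω)) = entropy' μ X + Real.log (Fintype.card B) := by
  have hc : (Fintype.card B : ℝ) ≠ 0 := by simp
  have key (p : ℝ) : (Fintype.card B : ℝ) * (p / Fintype.card B *
      Real.log (p / Fintype.card B)) = p * Real.log p - p * Real.log (Fintype.card B) := by
    by_cases hp : p = 0
    · simp [hp]
    · rw [Real.log_div hp hc]
      field_simp
  simp only [entropy', Fintype.sum_prod_type, h, Finset.sum_const, Finset.card_univ,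
    nsmul_eq_mul, key, Finset.sum_sub_distrib, ← Finset.sum_mul, sum_dist', hμ]
  ring

/-- A uniform variable on a finite group that is independent of `V` stays uniform and independent
of `f V` after translation by `g V`. -/
theorem entropy'_prod_translate [Fintype A] [Fintype B] [Fintype G] [AddGroup G] (μ : Ω → ℝ)
    (hμ : ∑ ω, μ ω = 1) (V : Ω → A) (T : Ω → G)
    (h : ∀ v t, dist' μ (fun ω => (V ω, T ω)) (v, t) = dist' μ V v / Fintype.card G)
    (f : A → B) (g : A → G) :
    entropy' μ (fun ω => (f (V ω), T ω + g (V ω))) =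
      entropy' μ (fun ω => f (V ω)) + Real.log (Fintype.card G) := by
  refine entropy'_prod_uniform μ hμ (fun ω => f (V ω)) (fun ω => T ω + g (V ω)) fun b s => ?_
  rw [dist'_comp_eq_sum μ (fun ω => (V ω, T ω)) (fun p => (f p.1, p.2 + g p.1)),
    dist'_comp_eq_sum μ V f, Finset.sum_div, Fintype.sum_prod_type]
  refine Finset.sum_congr rfl fun v _ => ?_
  by_cases hv : f v = b <;> simp [hv, h, ← eq_sub_iff_add_eq]

theorem dist'_prod_eq_div_card [Fintype B] [Nonempty B] (μ : Ω → ℝ) (V : Ω → A) (T : Ω → B)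
    (h : ∀ v t t', dist' μ (fun ω => (V ω, T ω)) (v, t) = dist' μ (fun ω => (V ω, T ω)) (v, t'))
    (v : A) (t : B) :
    dist' μ (fun ω => (V ω, T ω)) (v, t) = dist' μ V v / Fintype.card B := by
  rw [← sum_dist'_prod_right μ V T v, Finset.sum_congr rfl fun t' _ => h v t' t]
  simp

end

/-- For the additive two-way wiretap channel, `I(Y1;Z|X1) = log q − H(N1 − b1 b3⁻¹ N3)`. -/
theorem additive_cmi_Y1_Z_X1 {Ω F : Type*} [Fintype Ω] [Field F] [Fintype F] [DecidableEq F]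
    (μ : Ω → ℝ) (hμ0 : ∀ ω, 0 ≤ μ ω) (hμ1 : ∑ ω, μ ω = 1)
    (a1 b1 a2 b2 a3 b3 : F)
    (ha1 : a1 ≠ 0) (hb1 : b1 ≠ 0) (ha2 : a2 ≠ 0)
    (hb2 : b2 ≠ 0) (ha3 : a3 ≠ 0) (hb3 : b3 ≠ 0)
    (X1 X2 N1 N2 N3 : Ω → F)
    (hX1unif : ∀ x, dist' μ X1 x = 1 / (Fintype.card F : ℝ))
    (hX2unif : ∀ x, dist' μ X2 x = 1 / (Fintype.card F : ℝ))
    (hindep : ∀ x1 x2 n1 n2 n3,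
      dist' μ (fun ω => (X1 ω, X2 ω, N1 ω, N2 ω, N3 ω)) (x1, x2, n1, n2, n3) =
        dist' μ X1 x1 * dist' μ X2 x2 * dist' μ N1 n1 * dist' μ N2 n2 * dist' μ N3 n3) :
    cmi μ (fun ω => a1 * X1 ω + b1 * X2 ω + N1 ω)
        (fun ω => a3 * X1 ω + b3 * X2 ω + N3 ω) X1 =
      Real.log (Fintype.card F : ℝ) - entropy' μ (fun ω => N1 ω - b1 * b3⁻¹ * N3 ω) := by
  have hT (v : F × F × F) (t : F × F) :
      dist' μ (fun ω => ((N1 ω, N2 ω, N3 ω), (X1 ω, X2 ω))) (v, t) =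
        dist' μ (fun ω => (N1 ω, N2 ω, N3 ω)) v / Fintype.card (F × F) := by
    refine dist'_prod_eq_div_card μ (fun ω => (N1 ω, N2 ω, N3 ω)) (fun ω => (X1 ω, X2 ω))
      (fun v t t' => ?_) v t
    have hperm (t : F × F) :
        dist' μ (fun ω => ((N1 ω, N2 ω, N3 ω), (X1 ω, X2 ω))) (v, t) =
          dist' μ (fun ω => (X1 ω, X2 ω, N1 ω, N2 ω, N3 ω)) (t.1, t.2, v) := by
      refine dist'_comp_injective μ (fun ω => (X1 ω, X2 ω, N1 ω, N2 ω, N3 ω))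
        (f := fun p => (p.2.2, (p.1, p.2.1))) (fun p p' h => ?_) (t.1, t.2, v)
      grind
    simp only [hperm, hindep, hX1unif, hX2unif]
  have hlog : Real.log (Fintype.card (F × F)) = 2 * Real.log (Fintype.card F) := by
    rw [Fintype.card_prod, Nat.cast_mul, ← sq, Real.log_pow]
    norm_num
  have pair (a b : F) (hb : b ≠ 0) (n : F × F × F → F) :
      entropy' μ (fun ω => (a * X1 ω + b * X2 ω + n (N1 ω, N2 ω, N3 ω), X1 ω)) =
        2 * Real.log (Fintype.card F) := by
    have hbij : Function.Bijective
        (fun p : Unit × F × F => (a * p.2.1 + b * p.2.2, p.2.1)) := by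
      refine ⟨fun p p' h => ?_, fun y => ⟨((), y.2, b⁻¹ * (y.1 - a * y.2)), ?_⟩⟩
      · grind
      · ext <;> grind
    have h := entropy'_prod_translate μ hμ1 (fun ω => (N1 ω, N2 ω, N3 ω))
      (fun ω => (X1 ω, X2 ω)) hT (fun _ => ()) (fun v => (0, b⁻¹ * n v))
    rw [entropy'_const μ hμ1, hlog, zero_add, ← entropy'_comp_bijective μ _ hbij] at h
    rw [← h]
    congr! 3 with ω
    · simp only [Prod.mk_add_mk, add_zero]
      field_simp
      ring
    · simp
  have triple : entropy' μ (fun ω => (a1 * X1 ω + b1 * X2 ω + N1 ω,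
      a3 * X1 ω + b3 * X2 ω + N3 ω, X1 ω)) =
        entropy' μ (fun ω => N1 ω - b1 * b3⁻¹ * N3 ω) + 2 * Real.log (Fintype.card F) := by
    have hbij : Function.Bijective (fun p : F × F × F =>
        (a1 * p.2.1 + b1 * p.2.2 + p.1, a3 * p.2.1 + b3 * p.2.2, p.2.1)) := by
      refine ⟨fun p p' h => ?_, fun y => ⟨(y.1 - a1 * y.2.2 - b1 * (b3⁻¹ * (y.2.1 - a3 * y.2.2)),
        y.2.2, b3⁻¹ * (y.2.1 - a3 * y.2.2)), ?_⟩⟩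
      · grind
      · ext <;> grind
    have h := entropy'_prod_translate μ hμ1 (fun ω => (N1 ω, N2 ω, N3 ω))
      (fun ω => (X1 ω, X2 ω)) hT (fun v => v.1 - b1 * b3⁻¹ * v.2.2) (fun v => (0, b3⁻¹ * v.2.2))
    rw [hlog, ← entropy'_comp_bijective μ _ hbij] at h
    rw [← h]
    congr! 3 with ω
    · simp only [Prod.mk_add_mk, add_zero]
      ring
    · congr 1
      · simp only [Prod.mk_add_mk, add_zero]
        field_simp
        ring
      · simp
  rw [cmi, pair a1 b1 hb1 (fun v => v.1), pair a3 b3 hb3 (fun v => v.2.2), triple,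
    entropy'_uniform μ X1 hX1unif]
  ring

end
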